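/- arXiv:2309.06202 — 3 statements merged into one kernel-verified Lean document; each statement's English description precedes it below -/
import Mathlib

section
/- Let X ∈ ℝ^{d×n}, set S = XXᵀ, let λ > 0, η ∈ ℝ, ε > 0. For Ω ∈ ℝ^{d×d} with columns ω₁,…,ω_d define G(Ω) = Tr(ΩSΩᵀ) − 2Tr(SΩ) + η·Tr(Ω) and F(Ω) = G(Ω) + λ·Σⱼ₌₁^d √(‖ωⱼ‖₂² + ε). Suppose Ω, Ω̃ ∈ ℝ^{d×d} satisfy the surrogate inequality G(Ω̃) + λ·Σⱼ₌₁^d ‖ω̃ⱼ‖₂²/(2√(‖ωⱼ‖₂² + ε)) ≤ G(Ω) + λ·Σⱼ₌₁^d ‖ωⱼ‖₂²/(2√(‖ωⱼ‖₂² + ε)), where ω̃ⱼ are the columns of Ω̃. Then F(Ω̃) ≤ F(Ω). -/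
open Matrix BigOperators

/-- The graph of the square root lies below its tangent lines. -/
theorem Real.sqrt_le_sqrt_add_sub_div {a b : ℝ} (ha : 0 < a) (hb : 0 ≤ b) :
    √b ≤ √a + (b - a) / (2 * √a) := by
  have hpos : 0 < √a := Real.sqrt_pos.2 ha
  rw [← sub_le_iff_le_add', le_div_iff₀ (by positivity)]
  nlinarith [sq_nonneg (√b - √a), Real.sq_sqrt ha.le, Real.sq_sqrt hb]

/-- Theorem 2 (surrogate-majorization step): if the update `Ω̃` does not increase the
weighted surrogate objective (with weights computed from the current iterate `Ω`),
then it does not increase the ε-smoothed objective `F`. -/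
theorem stmt_2 {d n : ℕ} (X : Matrix (Fin d) (Fin n) ℝ)
    (lam η ε : ℝ) (hlam : 0 < lam) (hε : 0 < ε)
    (S : Matrix (Fin d) (Fin d) ℝ) (hS : S = X * Xᵀ)
    (colNormSq : Matrix (Fin d) (Fin d) ℝ → Fin d → ℝ)
    (hcol : ∀ Ω j, colNormSq Ω j = ∑ i, (Ω i j) ^ 2)
    (G F : Matrix (Fin d) (Fin d) ℝ → ℝ)
    (hG : ∀ Ω, G Ω = (Ω * S * Ωᵀ).trace - 2 * (S * Ω).trace + η * Ω.trace)
    (hF : ∀ Ω, F Ω = G Ω + lam * ∑ j, Real.sqrt (colNormSq Ω j + ε))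
    (Ω Ωt : Matrix (Fin d) (Fin d) ℝ)
    (hsurr : G Ωt + lam * ∑ j, colNormSq Ωt j / (2 * Real.sqrt (colNormSq Ω j + ε)) ≤
             G Ω + lam * ∑ j, colNormSq Ω j / (2 * Real.sqrt (colNormSq Ω j + ε))) :
    F Ωt ≤ F Ω := by
  have hnonneg (A : Matrix (Fin d) (Fin d) ℝ) (j : Fin d) : 0 ≤ colNormSq A j := by
    rw [hcol]
    positivity
  have hsum : ∑ j, √(colNormSq Ωt j + ε) ≤ ∑ j, √(colNormSq Ω j + ε) +
      (∑ j, colNormSq Ωt j / (2 * √(colNormSq Ω j + ε)) -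
        ∑ j, colNormSq Ω j / (2 * √(colNormSq Ω j + ε))) := by
    rw [← Finset.sum_sub_distrib, ← Finset.sum_add_distrib]
    refine Finset.sum_le_sum fun j _ => ?_
    have h := Real.sqrt_le_sqrt_add_sub_div (add_pos_of_nonneg_of_pos (hnonneg Ω j) hε)
      (add_nonneg (hnonneg Ωt j) hε.le)
    rwa [add_sub_add_right_eq_sub, sub_div] at h
  have hmul := mul_le_mul_of_nonneg_left hsum hlam.le
  rw [hF, hF]
  linarith
end

section
/- Let X ∈ ℝ^{d×n}, set S = XXᵀ, let λ > 0, η ∈ ℝ, ε > 0. Given Ω ∈ ℝ^{d×d} with columns ω₁,…,ω_d, let W ∈ ℝ^{d×d} be the diagonal matrix with diagonal entries wⱼⱼ = 1/(2√(‖ωⱼ‖₂² + ε)), and set Ω̃ = (S − (η/2)·I_d)(S + λW)⁻¹ (note S + λW is positive definite, hence invertible). Then F(Ω̃) ≤ F(Ω), where F(Ω) = Tr(ΩSΩᵀ) − 2Tr(SΩ) + η·Tr(Ω) + λ·Σⱼ₌₁^d √(‖ωⱼ‖₂² + ε). -/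
open Matrix BigOperators

/-- If `A * M = C` with `M` positive semidefinite and `C` symmetric, then `A` minimizes the
quadratic `B ↦ Tr (B M Bᵀ) - 2 Tr (C B)`. -/
theorem trace_quadratic_le_of_mul_eq {m : Type*} [Fintype m]
    {M C A : Matrix m m ℝ} (hM : M.PosSemidef) (hC : Cᵀ = C) (hA : A * M = C)
    (B : Matrix m m ℝ) :
    (A * M * Aᵀ).trace - 2 * (C * A).trace ≤ (B * M * Bᵀ).trace - 2 * (C * B).trace := by
  have hMt : Mᵀ = M := by simpa using hM.isHermitian.eq
  have htr (D : Matrix m m ℝ) : (C * Dᵀ).trace = (C * D).trace := by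
    rw [← trace_transpose, transpose_mul, transpose_transpose, hC, trace_mul_comm]
  have hMA : M * Aᵀ = C := by
    rw [← hC, ← hA, transpose_mul, hMt]
  have hpos : 0 ≤ ((B - A) * M * (B - A)ᵀ).trace := by
    simpa using (hM.mul_mul_conjTranspose_same (B - A)).trace_nonneg
  have hexp : ((B - A) * M * (B - A)ᵀ).trace =
      (B * M * Bᵀ).trace - 2 * (C * B).trace + (C * A).trace := by
    rw [transpose_sub, Matrix.mul_sub, Matrix.sub_mul, hA, Matrix.sub_mul,
      Matrix.sub_mul, Matrix.mul_assoc B M Aᵀ, hMA]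
    simp only [trace_sub, htr]
    rw [trace_mul_comm B C]
    ring
  rw [hA, htr]
  linarith

theorem trace_mul_diagonal_mul_transpose {m : Type*} [Fintype m] [DecidableEq m]
    (A : Matrix m m ℝ) (w : m → ℝ) :
    (A * diagonal w * Aᵀ).trace = ∑ j, w j * ∑ i, (A i j) ^ 2 := by
  simp only [trace, diag_apply, mul_apply (M := A * diagonal w), mul_diagonal, transpose_apply,
    Finset.mul_sum]
  rw [Finset.sum_comm]
  exact Finset.sum_congr rfl fun _ _ => Finset.sum_congr rfl fun _ _ => by ring

theorem Real.sqrt_sub_div_two_mul_sqrt_le {a b : ℝ} (ha : 0 < a) (hb : 0 ≤ b) :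
    √b - b / (2 * √a) ≤ √a - a / (2 * √a) := by
  have hs : 0 < √a := Real.sqrt_pos.2 ha
  have h : √a - a / (2 * √a) - (√b - b / (2 * √a)) = (√b - √a) ^ 2 / (2 * √a) := by
    field_simp
    nlinarith [Real.sq_sqrt ha.le, Real.sq_sqrt hb]
  have : 0 ≤ (√b - √a) ^ 2 / (2 * √a) := by positivity
  linarith

/-- The closed-form update (16) of Algorithm 1 (without the PSD projection)
does not increase the ε-smoothed objective `F`. -/
theorem stmt_3 {d n : ℕ} (X : Matrix (Fin d) (Fin n) ℝ)
    (lam η ε : ℝ) (hlam : 0 < lam) (hε : 0 < ε)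
    (S : Matrix (Fin d) (Fin d) ℝ) (hS : S = X * Xᵀ)
    (colNormSq : Matrix (Fin d) (Fin d) ℝ → Fin d → ℝ)
    (hcol : ∀ Ω j, colNormSq Ω j = ∑ i, (Ω i j) ^ 2)
    (F : Matrix (Fin d) (Fin d) ℝ → ℝ)
    (hF : ∀ Ω, F Ω = (Ω * S * Ωᵀ).trace - 2 * (S * Ω).trace + η * Ω.trace +
        lam * ∑ j, Real.sqrt (colNormSq Ω j + ε))
    (Ω : Matrix (Fin d) (Fin d) ℝ)
    (W : Matrix (Fin d) (Fin d) ℝ)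
    (hW : W = Matrix.diagonal (fun j => 1 / (2 * Real.sqrt (colNormSq Ω j + ε))))
    (Ωt : Matrix (Fin d) (Fin d) ℝ)
    (hΩt : Ωt = (S - (η / 2) • (1 : Matrix (Fin d) (Fin d) ℝ)) * (S + lam • W)⁻¹) :
    F Ωt ≤ F Ω := by
  have hpos (A : Matrix (Fin d) (Fin d) ℝ) (j : Fin d) : 0 < colNormSq A j + ε := by
    rw [hcol]; positivity
  have hSpsd : S.PosSemidef := by
    simpa [hS] using posSemidef_self_mul_conjTranspose X
  have hSt : Sᵀ = S := by simp [hS]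
  have hWpd : W.PosDef := by
    rw [hW, posDef_diagonal_iff]
    intro j
    have := Real.sqrt_pos.2 (hpos Ω j)
    positivity
  have hMpd : (S + lam • W).PosDef := hWpd.smul hlam |>.posSemidef_add hSpsd
  have hmul : Ωt * (S + lam • W) = S - (η / 2) • 1 := by
    rw [hΩt, Matrix.mul_assoc, nonsing_inv_mul _ ((isUnit_iff_isUnit_det _).1 hMpd.isUnit),
      Matrix.mul_one]
  have hquad := trace_quadratic_le_of_mul_eq hMpd.posSemidef (by simp [hSt]) hmul Ω
  have hWtr (A : Matrix (Fin d) (Fin d) ℝ) : (A * W * Aᵀ).trace =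
      ∑ j, colNormSq A j / (2 * √(colNormSq Ω j + ε)) := by
    rw [hW, trace_mul_diagonal_mul_transpose]
    exact Finset.sum_congr rfl fun j _ => by rw [hcol A]; ring
  have hsqrt : ∑ j, √(colNormSq Ωt j + ε) - (Ωt * W * Ωtᵀ).trace ≤
      ∑ j, √(colNormSq Ω j + ε) - (Ω * W * Ωᵀ).trace := by
    rw [hWtr, hWtr, ← Finset.sum_sub_distrib, ← Finset.sum_sub_distrib]
    refine Finset.sum_le_sum fun j _ => ?_
    have := Real.sqrt_sub_div_two_mul_sqrt_le (hpos Ω j) (hpos Ωt j).le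
    rw [add_div, add_div] at this
    linarith
  have hscaled := mul_le_mul_of_nonneg_left hsqrt hlam.le
  simp only [Matrix.mul_add, Matrix.add_mul, Matrix.sub_mul, Matrix.mul_smul, Matrix.smul_mul,
    Matrix.one_mul, trace_add, trace_sub, trace_smul, smul_eq_mul] at hquad
  rw [hF, hF]
  linarith
end

section
/- Let X ∈ ℝ^{d×n}, set S = XXᵀ, let λ > 0, η ∈ ℝ, and let W ∈ ℝ^{d×d} be a diagonal matrix with strictly positive diagonal entries. Then S + λW is invertible, and the function J(Ω) = Tr(ΩSΩᵀ) − 2Tr(SΩ) + λ·Tr(ΩWΩᵀ) + η·Tr(Ω) over Ω ∈ ℝ^{d×d} attains its unique global minimum at Ω* = (S − (η/2)·I_d)(S + λW)⁻¹; that is, J(Ω*) ≤ J(Ω) for all Ω ∈ ℝ^{d×d}. -/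
open Matrix BigOperators

namespace Matrix

variable {m n : Type*} [Fintype m] [Fintype n]

theorem PosDef.trace_mul_mul_transpose_nonneg {A : Matrix n n ℝ} (hA : A.PosDef)
    (D : Matrix m n ℝ) : 0 ≤ (D * A * Dᵀ).trace := by
  simpa using (hA.posSemidef.mul_mul_conjTranspose_same D).trace_nonneg

theorem PosDef.eq_zero_of_trace_mul_mul_transpose_eq_zero {A : Matrix n n ℝ} (hA : A.PosDef)
    {D : Matrix m n ℝ} (h : (D * A * Dᵀ).trace = 0) : D = 0 := by
  have h0 : D * A * Dᴴ = 0 :=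
    (hA.posSemidef.mul_mul_conjTranspose_same D).trace_eq_zero_iff.mp (by simpa using h)
  funext i
  by_contra hi
  have hpos := hA.dotProduct_mulVec_pos (x := D i) hi
  have hii : D i ⬝ᵥ (A *ᵥ D i) = 0 := by
    rw [dotProduct_mulVec]
    exact congrFun (congrFun h0 i) i
  simp [hii] at hpos

/-- Completing the square for the quadratic `Ω ↦ Tr(ΩAΩᵀ) - 2 Tr(BΩ)` at a solution of `PA = B`. -/
theorem trace_quadratic_eq_add {A B P : Matrix n n ℝ} (hA : A.IsSymm) (hB : B.IsSymm)
    (hP : P * A = B) (Ω : Matrix n n ℝ) :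
    (Ω * A * Ωᵀ).trace - 2 * (B * Ω).trace =
      (P * A * Pᵀ).trace - 2 * (B * P).trace + ((Ω - P) * A * (Ω - P)ᵀ).trace := by
  have hAP : A * Pᵀ = B := by
    rw [← hB.eq, ← hP, transpose_mul, hA.eq]
  have hBt (M : Matrix n n ℝ) : (B * Mᵀ).trace = (B * M).trace := by
    rw [← trace_transpose, transpose_mul, transpose_transpose, hB.eq, trace_mul_comm]
  have hcross : (Ω * A * Pᵀ).trace = (B * Ω).trace := by
    rw [Matrix.mul_assoc, hAP, trace_mul_comm]
  simp only [transpose_sub, Matrix.sub_mul, Matrix.mul_sub, trace_sub, hcross, hP, hBt]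
  ring

end Matrix

/-- Closed-form unconstrained minimizer (16) of Algorithm 1: with `S = XXᵀ`, `λ > 0`,
and `W` diagonal with strictly positive entries, `S + λW` is invertible and
`J(Ω) = Tr(ΩSΩᵀ) − 2Tr(SΩ) + λTr(ΩWΩᵀ) + ηTr(Ω)` attains its unique global
minimum at `Ω* = (S − (η/2)I)(S + λW)⁻¹`. -/
theorem stmt_6 {d n : ℕ} (X : Matrix (Fin d) (Fin n) ℝ)
    (lam η : ℝ) (hlam : 0 < lam)
    (S : Matrix (Fin d) (Fin d) ℝ) (hS : S = X * Xᵀ)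
    (w : Fin d → ℝ) (hw : ∀ j, 0 < w j)
    (W : Matrix (Fin d) (Fin d) ℝ) (hW : W = Matrix.diagonal w)
    (J : Matrix (Fin d) (Fin d) ℝ → ℝ)
    (hJ : ∀ Ω, J Ω = (Ω * S * Ωᵀ).trace - 2 * (S * Ω).trace +
        lam * (Ω * W * Ωᵀ).trace + η * Ω.trace)
    (Ωstar : Matrix (Fin d) (Fin d) ℝ)
    (hΩ : Ωstar = (S - (η / 2) • (1 : Matrix (Fin d) (Fin d) ℝ)) * (S + lam • W)⁻¹) :
    IsUnit (S + lam • W) ∧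
      (∀ Ω, J Ωstar ≤ J Ω) ∧ (∀ Ω, J Ω = J Ωstar → Ω = Ωstar) := by
  have hSsymm : S.IsSymm := by simp [hS, IsSymm]
  have hSpos : S.PosSemidef := by
    simpa [hS] using posSemidef_self_mul_conjTranspose X
  have hWpos : W.PosDef := hW ▸ PosDef.diagonal hw
  have hA : (S + lam • W).PosDef := PosDef.posSemidef_add hSpos (hWpos.smul hlam)
  have hAsymm : (S + lam • W).IsSymm := by simpa [IsHermitian, IsSymm] using hA.isHermitian
  have hB : (S - (η / 2) • (1 : Matrix (Fin d) (Fin d) ℝ)).IsSymm :=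
    hSsymm.sub (isSymm_one.smul _)
  have hP : Ωstar * (S + lam • W) = S - (η / 2) • (1 : Matrix (Fin d) (Fin d) ℝ) := by
    rw [hΩ, nonsing_inv_mul_cancel_right _ _ ((isUnit_iff_isUnit_det _).mp hA.isUnit)]
  have hJ' (Ω) : J Ω = (Ω * (S + lam • W) * Ωᵀ).trace -
      2 * ((S - (η / 2) • (1 : Matrix (Fin d) (Fin d) ℝ)) * Ω).trace := by
    simp only [hJ, Matrix.mul_add, Matrix.add_mul, Matrix.sub_mul, Matrix.mul_smul,
      Matrix.smul_mul, Matrix.one_mul, trace_add, trace_sub, trace_smul, smul_eq_mul]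
    ring
  have hsq (Ω) : J Ω = J Ωstar + ((Ω - Ωstar) * (S + lam • W) * (Ω - Ωstar)ᵀ).trace := by
    rw [hJ', hJ', trace_quadratic_eq_add hAsymm hB hP Ω]
  refine ⟨hA.isUnit, fun Ω => ?_, fun Ω h => ?_⟩
  · rw [hsq Ω]
    exact le_add_of_nonneg_right (hA.trace_mul_mul_transpose_nonneg _)
  · rw [hsq Ω, add_eq_left] at h
    exact sub_eq_zero.mp (hA.eq_zero_of_trace_mul_mul_transpose_eq_zero h)
end
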